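/- Fix an integer n ≥ 2 and c ∈ (0,1). For every θ ∈ (−π/2, π/2) and every integer k, one has ρ_c(θ, 2kπ/n) = sin(f_c(θ)) and ρ_c(θ, (2k+1)π/n) = sin(g_c(θ)); moreover, the functions θ ↦ sin(f_c(θ)) and θ ↦ sin(g_c(θ)) are strictly increasing on [−π/2, π/2]. -/

import Mathlib

open Real Set Filter Topology

/-- `Fc c x` is the function `F_c(x)` from the paper. -/
noncomputable def Fc (c x : ℝ) : ℝ :=
  (c * x ^ 2 + (1 - c) * (1 - x) ^ 2 * (c * x / (c + x))) / (c * x + (1 - c) * (1 - x) ^ 2)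

/-- `fc c θ = π·F_c(θ/π + 1/2) − π/2`. -/
noncomputable def fc (c θ : ℝ) : ℝ := π * Fc c (θ / π + 1 / 2) - π / 2

/-- `gc c θ = −f_c(−θ)`. -/
noncomputable def gc (c θ : ℝ) : ℝ := -fc c (-θ)

/-- `ac n c θ φ` is the function `a_c(θ,φ)` from the paper. -/
noncomputable def ac (n : ℕ) (c θ φ : ℝ) : ℝ :=
  Real.cos (n * φ / 2) ^ 2 * Real.cos (fc c θ) ^ 2 /
    (Real.cos (n * φ / 2) ^ 2 * Real.cos (fc c θ) ^ 2 +
      Real.sin (n * φ / 2) ^ 2 * Real.cos (gc c θ) ^ 2)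

/-- `ρc n c θ φ` is the function `ρ_c(θ,φ)` from the paper. -/
noncomputable def ρc (n : ℕ) (c θ φ : ℝ) : ℝ :=
  ac n c θ φ * Real.sin (fc c θ) + (1 - ac n c θ φ) * Real.sin (gc c θ)

theorem Fc_eq (c x : ℝ) (hc0 : 0 < c) (hc1 : c < 1) (hx0 : 0 ≤ x) :
    Fc c x = c * x / (c + x) +
      c * x / (c * x + (1 - c) * (1 - x) ^ 2) * (x ^ 2 / (c + x)) := by
  have h1 : 0 < c + x := by linarith
  have h2 : 0 < c * x + (1 - c) * (1 - x) ^ 2 := by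
    rcases hx0.eq_or_lt with h | h
    · subst h; norm_num; exact hc1
    · have := mul_pos hc0 h
      have := mul_nonneg (sub_nonneg.2 hc1.le) (sq_nonneg (1 - x))
      linarith
  unfold Fc
  field_simp
  ring

theorem Fc_strictMono (c : ℝ) (hc0 : 0 < c) (hc1 : c < 1) :
    StrictMonoOn (Fc c) (Set.Icc 0 1) := by
  intro x hx y hy hxy
  obtain ⟨hx0, hx1⟩ := hx
  obtain ⟨hy0, hy1⟩ := hy
  have hd : ∀ x : ℝ, 0 ≤ x → 0 < c * x + (1 - c) * (1 - x) ^ 2 := by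
    intro x hx0
    rcases hx0.eq_or_lt with h | h
    · subst h; norm_num; exact hc1
    · have := mul_pos hc0 h
      have := mul_nonneg (sub_nonneg.2 hc1.le) (sq_nonneg (1 - x))
      linarith
  rw [Fc_eq c x hc0 hc1 hx0, Fc_eq c y hc0 hc1 hy0]
  have h1 : c * x / (c + x) < c * y / (c + y) := by
    rw [div_lt_div_iff₀ (by linarith) (by linarith)]
    nlinarith [mul_pos (mul_pos hc0 hc0) (sub_pos.2 hxy)]
  have h2 : c * x / (c * x + (1 - c) * (1 - x) ^ 2) ≤
      c * y / (c * y + (1 - c) * (1 - y) ^ 2) := by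
    rw [div_le_div_iff₀ (hd x hx0) (hd y hy0)]
    have h3 : (1 - y) ^ 2 ≤ (1 - x) ^ 2 := by
      apply pow_le_pow_left₀ <;> linarith
    have h4 : x * (1 - y) ^ 2 ≤ y * (1 - x) ^ 2 :=
      mul_le_mul hxy.le h3 (sq_nonneg _) hy0
    have h5 := mul_le_mul_of_nonneg_left h4 (mul_nonneg hc0.le (sub_nonneg.2 hc1.le))
    nlinarith [h5]
  have h6 : x ^ 2 / (c + x) ≤ y ^ 2 / (c + y) := by
    rw [div_le_div_iff₀ (by linarith) (by linarith)]
    have h7 : x ^ 2 ≤ y ^ 2 := pow_le_pow_left₀ hx0 hxy.le 2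
    have h8 := mul_le_mul_of_nonneg_left h7 hc0.le
    have h9 := mul_le_mul_of_nonneg_left hxy.le (mul_nonneg hx0 hy0)
    nlinarith [h8, h9]
  have := mul_le_mul h2 h6 (div_nonneg (sq_nonneg _) (by linarith))
    (div_nonneg (mul_nonneg hc0.le hy0) (hd y hy0).le)
  linarith

theorem fc_strictMono (c : ℝ) (hc0 : 0 < c) (hc1 : c < 1) :
    StrictMonoOn (fc c) (Set.Icc (-(π / 2)) (π / 2)) := by
  have hm : ∀ x ∈ Set.Icc (-(π / 2)) (π / 2), x / π + 1 / 2 ∈ Set.Icc (0 : ℝ) 1 := by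
    intro x hx
    have e : x / π + 1 / 2 = (x + π / 2) / π := by field_simp
    rw [e]
    constructor
    · exact div_nonneg (by linarith [hx.1]) pi_pos.le
    · rw [div_le_one pi_pos]; linarith [hx.2]
  intro x hx y hy hxy
  have h := Fc_strictMono c hc0 hc1 (hm x hx) (hm y hy)
    (by have := div_lt_div_of_pos_right hxy pi_pos; linarith)
  have := mul_lt_mul_of_pos_left h pi_pos
  unfold fc
  linarith

theorem fc_left (c : ℝ) : fc c (-(π / 2)) = -(π / 2) := by
  have e : -(π / 2) / π + 1 / 2 = 0 := by field_simp; norm_num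
  unfold fc Fc
  rw [e]; simp

theorem fc_right (c : ℝ) (hc0 : 0 < c) : fc c (π / 2) = π / 2 := by
  have e : (π / 2) / π + 1 / 2 = 1 := by field_simp; norm_num
  unfold fc Fc
  rw [e]; simp [hc0.ne']; ring

theorem fc_mem (c : ℝ) (hc0 : 0 < c) (hc1 : c < 1) (x : ℝ)
    (hx : x ∈ Set.Icc (-(π / 2)) (π / 2)) : fc c x ∈ Set.Icc (-(π / 2)) (π / 2) := by
  have hm := (fc_strictMono c hc0 hc1).monotoneOn
  have hp := pi_pos
  have h1 := hm (left_mem_Icc.2 (by linarith)) hx hx.1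
  have h2 := hm hx (right_mem_Icc.2 (by linarith)) hx.2
  rw [fc_left] at h1
  rw [fc_right c hc0] at h2
  exact ⟨h1, h2⟩

theorem fc_mem_Ioo (c : ℝ) (hc0 : 0 < c) (hc1 : c < 1) (x : ℝ)
    (hx : x ∈ Set.Ioo (-(π / 2)) (π / 2)) : fc c x ∈ Set.Ioo (-(π / 2)) (π / 2) := by
  have hm := fc_strictMono c hc0 hc1
  have hp := pi_pos
  have h1 := hm (left_mem_Icc.2 (by linarith)) (Ioo_subset_Icc_self hx) hx.1
  have h2 := hm (Ioo_subset_Icc_self hx) (right_mem_Icc.2 (by linarith)) hx.2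
  rw [fc_left] at h1
  rw [fc_right c hc0] at h2
  exact ⟨h1, h2⟩

theorem stmt_15 (n : ℕ) (hn : 2 ≤ n) (c : ℝ) (hc : c ∈ Set.Ioo (0 : ℝ) 1)
    (θ : ℝ) (hθ : θ ∈ Set.Ioo (-(π / 2)) (π / 2)) (k : ℤ) :
    ρc n c θ (2 * k * π / n) = Real.sin (fc c θ) ∧
      ρc n c θ ((2 * k + 1) * π / n) = Real.sin (gc c θ) ∧
      StrictMonoOn (fun t => Real.sin (fc c t)) (Set.Icc (-(π / 2)) (π / 2)) ∧
      StrictMonoOn (fun t => Real.sin (gc c t)) (Set.Icc (-(π / 2)) (π / 2)) := by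
  obtain ⟨hc0, hc1⟩ := hc
  have hn0 : (n : ℝ) ≠ 0 := by
    have : n ≠ 0 := by omega
    exact_mod_cast this
  have neg_mem : ∀ t ∈ Set.Icc (-(π / 2)) (π / 2), -t ∈ Set.Icc (-(π / 2)) (π / 2) := by
    intro t ht
    exact ⟨by linarith [ht.2], by linarith [ht.1]⟩
  refine ⟨?_, ?_, ?_, ?_⟩
  · have e : (n : ℝ) * (2 * k * π / n) / 2 = k * π := by field_simp
    have hs : Real.sin (k * π) = 0 := Real.sin_int_mul_pi k
    have hcs : Real.cos (k * π) ^ 2 = 1 := by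
      have := Real.sin_sq_add_cos_sq (k * π)
      rw [hs] at this
      linarith
    have hf : Real.cos (fc c θ) ≠ 0 :=
      (Real.cos_pos_of_mem_Ioo (fc_mem_Ioo c hc0 hc1 θ hθ)).ne'
    have ha : ac n c θ (2 * k * π / n) = 1 := by
      unfold ac
      rw [e, hs, hcs]
      field_simp
      simp
    unfold ρc
    rw [ha]; ring
  · have e : (n : ℝ) * ((2 * k + 1) * π / n) / 2 = (2 * k + 1) * π / 2 := by field_simp
    have hcs : Real.cos ((2 * k + 1) * π / 2) = 0 := Real.cos_eq_zero_iff.2 ⟨k, rfl⟩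
    have ha : ac n c θ ((2 * k + 1) * π / n) = 0 := by
      unfold ac
      rw [e, hcs]
      simp
    unfold ρc
    rw [ha]; ring
  · intro x hx y hy hxy
    exact Real.strictMonoOn_sin (fc_mem c hc0 hc1 x hx) (fc_mem c hc0 hc1 y hy)
      (fc_strictMono c hc0 hc1 hx hy hxy)
  · intro x hx y hy hxy
    exact Real.strictMonoOn_sin (neg_mem _ (fc_mem c hc0 hc1 _ (neg_mem x hx)))
      (neg_mem _ (fc_mem c hc0 hc1 _ (neg_mem y hy)))
      (neg_lt_neg (fc_strictMono c hc0 hc1 (neg_mem y hy) (neg_mem x hx) (neg_lt_neg hxy)))
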